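/- Let f : ℝ² → ℍ with ∫_{ℝ²} |f(s,t)| ds dt < ∞, and suppose its two-sided quaternion linear canonical transform 𝓛_T(f) satisfies ∫_{ℝ²} |𝓛_T(f)(u,v)| du dv < ∞. Then f(s,t) = ∫_{ℝ²} K_{A₁⁻¹}^i(u,s) 𝓛_T(f)(u,v) K_{A₂⁻¹}^j(v,t) du dv for almost every (s,t) ∈ ℝ². -/

import Mathlib

open MeasureTheory Filter Real Set
open scoped Quaternion Topology

noncomputable section

def qi : ℍ[ℝ] := ⟨0,1,0,0⟩
def qj : ℍ[ℝ] := ⟨0,0,1,0⟩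

/-- `e^{μθ} = cos θ + μ sin θ` for a (pure unit) quaternion `μ`. -/
def qexp (μ : ℍ[ℝ]) (θ : ℝ) : ℍ[ℝ] := (Real.cos θ : ℍ[ℝ]) + Real.sin θ • μ

/-- QLCT kernel `K_{A₁}^i(s,u) = (2πb)^{-1/2} e^{-iπ/4} e^{i(a s²/(2b) − su/b + d u²/(2b))}`. -/
def KAi (a b d s u : ℝ) : ℍ[ℝ] :=
  (Real.sqrt (2 * π * b))⁻¹ •
    (qexp qi (-(π / 4)) * qexp qi (a * s ^ 2 / (2 * b) - s * u / b + d * u ^ 2 / (2 * b)))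

/-- QLCT kernel `K_{A₂}^j(t,v) = (2πb)^{-1/2} e^{-jπ/4} e^{j(a t²/(2b) − tv/b + d v²/(2b))}`. -/
def KAj (a b d t v : ℝ) : ℍ[ℝ] :=
  (Real.sqrt (2 * π * b))⁻¹ •
    (qexp qj (-(π / 4)) * qexp qj (a * t ^ 2 / (2 * b) - t * v / b + d * v ^ 2 / (2 * b)))

/-- Inverse QLCT kernel `K_{A₁⁻¹}^i(u,s) = (2πb)^{-1/2} e^{iπ/4} e^{i(−d u²/(2b) + us/b − a s²/(2b))}`. -/
def KAiInv (a b d u s : ℝ) : ℍ[ℝ] :=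
  (Real.sqrt (2 * π * b))⁻¹ •
    (qexp qi (π / 4) * qexp qi (-(d * u ^ 2 / (2 * b)) + u * s / b - a * s ^ 2 / (2 * b)))

/-- Inverse QLCT kernel `K_{A₂⁻¹}^j(v,t) = (2πb)^{-1/2} e^{jπ/4} e^{j(−d v²/(2b) + vt/b − a t²/(2b))}`. -/
def KAjInv (a b d v t : ℝ) : ℍ[ℝ] :=
  (Real.sqrt (2 * π * b))⁻¹ •
    (qexp qj (π / 4) * qexp qj (-(d * v ^ 2 / (2 * b)) + v * t / b - a * t ^ 2 / (2 * b)))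

/-- Two-sided quaternion linear canonical transform. -/
def QLCT_T (a₁ b₁ d₁ a₂ b₂ d₂ : ℝ) (f : ℝ × ℝ → ℍ[ℝ]) (u v : ℝ) : ℍ[ℝ] :=
  ∫ p : ℝ × ℝ, KAi a₁ b₁ d₁ p.1 u * f p * KAj a₂ b₂ d₂ p.2 v

open scoped FourierTransform SchwartzMap ContDiff in
lemma fourier_inv_ae {V : Type*} [NormedAddCommGroup V] [InnerProductSpace ℝ V]
    [MeasurableSpace V] [BorelSpace V] [FiniteDimensional ℝ V] (f : V → ℂ)
    (hf : Integrable f) (hF : Integrable (𝓕 f)) : ∀ᵐ x, f x = 𝓕⁻ (𝓕 f) x := by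
  have hcont : Continuous (𝓕⁻ (𝓕 f)) := by
    have B : Continuous fun p : V × V => (- innerₗ V) p.1 p.2 := continuous_inner.neg
    exact VectorFourier.fourierIntegral_continuous Real.continuous_fourierChar B hF
  apply ae_eq_of_integral_contDiff_smul_eq hf.locallyIntegrable hcont.locallyIntegrable
  intro g g_smooth g_cpt
  have hg₁ : HasCompactSupport (Complex.ofRealCLM ∘ g) := g_cpt.comp_left rfl
  have hg₂ : ContDiff ℝ ∞ (Complex.ofRealCLM ∘ g) := by fun_prop
  set φ : 𝓢(V, ℂ) := hg₁.toSchwartzMap hg₂ with hφ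
  have hφg : ∀ x, φ x = (g x : ℂ) := fun x => rfl
  set ψ : 𝓢(V, ℂ) := 𝓕⁻ φ with hψ
  have h1 : ∀ x, 𝓕 (ψ : V → ℂ) x = φ x := by
    intro x
    rw [← SchwartzMap.fourier_coe, hψ]; simp
  have h2 : ∀ x, 𝓕⁻ (φ : V → ℂ) x = ψ x := by
    intro x
    rw [← SchwartzMap.fourierInv_coe]
  have e1 : ∫ x, 𝓕 (ψ : V → ℂ) x • f x = ∫ x, ψ x • 𝓕 f x := by
    simpa using! (VectorFourier.integral_fourierIntegral_smul_eq_flip (L := innerₗ V)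
      Real.continuous_fourierChar continuous_inner ψ.integrable hf)
  have e2 : ∫ x, 𝓕⁻ (φ : V → ℂ) x • 𝓕 f x = ∫ x, φ x • 𝓕⁻ (𝓕 f) x := by
    have B : Continuous fun p : V × V => (- innerₗ V) p.1 p.2 := continuous_inner.neg
    have := (VectorFourier.integral_fourierIntegral_smul_eq_flip (L := -innerₗ V)
      Real.continuous_fourierChar B (μ := volume) (φ.integrable (μ := volume)) hF)
    have hfl : (-innerₗ V).flip = -innerₗ V := by ext; simp [real_inner_comm]
    rw [hfl] at this
    exact this
  simp only [h1, h2, hφg] at e1 e2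
  simp only [← Complex.coe_smul]
  rw [e1, e2]

open scoped FourierTransform in
lemma fourier_inv_ae_prod (g : ℝ × ℝ → ℂ) (hg : Integrable g)
    (hG : Integrable (fun q : ℝ × ℝ => ∫ p : ℝ × ℝ,
      Complex.exp (((-2 * π * (p.1 * q.1 + p.2 * q.2) : ℝ) : ℂ) * Complex.I) * g p)) :
    ∀ᵐ p : ℝ × ℝ, g p = ∫ q : ℝ × ℝ,
      Complex.exp (((2 * π * (p.1 * q.1 + p.2 * q.2) : ℝ) : ℂ) * Complex.I) *
      ∫ p : ℝ × ℝ,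
      Complex.exp (((-2 * π * (p.1 * q.1 + p.2 * q.2) : ℝ) : ℂ) * Complex.I) * g p := by
  have mp := WithLp.volume_preserving_ofLp ℝ ℝ
  have me : MeasurableEmbedding (@WithLp.ofLp 2 (ℝ × ℝ)) :=
    (MeasurableEquiv.toLp 2 (ℝ × ℝ)).symm.measurableEmbedding
  set f : WithLp 2 (ℝ × ℝ) → ℂ := fun x => g (WithLp.ofLp x) with hfdef
  have hf : Integrable f := (mp.integrable_comp_emb me).2 hg
  have hFG : ∀ x, 𝓕 f x = ∫ p : ℝ × ℝ,
      Complex.exp (((-2 * π * (p.1 * x.fst + p.2 * x.snd) : ℝ) : ℂ) * Complex.I) * g p := by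
    intro x
    rw [← mp.integral_comp me, Real.fourier_eq']
    congr 1
    ext y
    simp [hfdef, WithLp.prod_inner_apply]
    left; congr 1; ring
  have hF : Integrable (𝓕 f) := by
    have := (mp.integrable_comp_emb me).2 hG
    refine this.congr (ae_of_all _ fun x => ?_)
    exact (hFG x).symm
  have h := fourier_inv_ae f hf hF
  have mp' := (WithLp.volume_preserving_toLp ℝ ℝ)
  have h' := mp'.quasiMeasurePreserving.ae h
  filter_upwards [h'] with p hp
  have : g p = f (WithLp.toLp 2 p) := rfl
  rw [this, hp, Real.fourierInv_eq', ← mp.integral_comp me]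
  congr 1
  ext y
  rw [hFG]
  simp [WithLp.prod_inner_apply]

lemma map_scale (c d : ℝ) (hc : c ≠ 0) (hd : d ≠ 0) :
    Measure.map (fun q : ℝ × ℝ => (c * q.1, d * q.2)) volume =
      (ENNReal.ofReal |c⁻¹ * d⁻¹|) • (volume : Measure (ℝ × ℝ)) := by
  have := Measure.map_prod_map (volume : Measure ℝ) (volume : Measure ℝ)
    (measurable_const_mul c) (measurable_const_mul d)
  rw [Real.map_volume_mul_left hc, Real.map_volume_mul_left hd] at this
  rw [Measure.volume_eq_prod]
  refine Eq.trans this.symm ?_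
  rw [Measure.prod_smul_left, Measure.prod_smul_right, smul_smul, abs_mul,
    ENNReal.ofReal_mul (abs_nonneg _)]

lemma scale_emb (c d : ℝ) (hc : c ≠ 0) (hd : d ≠ 0) :
    MeasurableEmbedding (fun q : ℝ × ℝ => (c * q.1, d * q.2)) :=
  (((Homeomorph.mulLeft₀ c hc).prodCongr (Homeomorph.mulLeft₀ d hd))).measurableEmbedding

lemma cexp_comb (a b z : ℂ) : Complex.exp a * (Complex.exp b * z) = Complex.exp (a + b) * z := by
  rw [← mul_assoc, Complex.exp_add]

lemma scalar_inv (A B : ℝ × ℝ → ℝ) (hA : Continuous A) (hB : Continuous B) (c d : ℝ)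
    (hc : c ≠ 0) (hd : d ≠ 0)
    (h : ℝ × ℝ → ℂ) (hh : Integrable h)
    (hH : Integrable (fun q : ℝ × ℝ => ∫ p : ℝ × ℝ,
      Complex.exp (((A p - 2 * π * (p.1 * (c * q.1) + p.2 * (d * q.2)) + B q : ℝ) : ℂ) * Complex.I)
        * h p)) :
    ∀ᵐ p : ℝ × ℝ, h p = |c * d| • ∫ q : ℝ × ℝ,
      Complex.exp (((-(A p - 2 * π * (p.1 * (c * q.1) + p.2 * (d * q.2)) + B q) : ℝ) : ℂ)
        * Complex.I) * ∫ p : ℝ × ℝ,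
      Complex.exp (((A p - 2 * π * (p.1 * (c * q.1) + p.2 * (d * q.2)) + B q : ℝ) : ℂ) * Complex.I)
        * h p := by
  set g : ℝ × ℝ → ℂ := fun p => Complex.exp ((A p : ℂ) * Complex.I) * h p with hgdef
  set G : ℝ × ℝ → ℂ := fun q => ∫ p : ℝ × ℝ,
      Complex.exp (((-2 * π * (p.1 * q.1 + p.2 * q.2) : ℝ) : ℂ) * Complex.I) * g p with hGdef
  have key : ∀ q : ℝ × ℝ, (∫ p : ℝ × ℝ,
      Complex.exp (((A p - 2 * π * (p.1 * (c * q.1) + p.2 * (d * q.2)) + B q : ℝ) : ℂ) * Complex.I)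
        * h p) = Complex.exp ((B q : ℂ) * Complex.I) * G (c * q.1, d * q.2) := by
    intro q
    rw [hGdef]
    simp only
    rw [← integral_const_mul]
    congr 1
    ext p
    rw [hgdef]
    simp only
    simp only [cexp_comb]
    congr 2
    push_cast; ring
  simp only [key] at hH ⊢
  have hg : Integrable g := by
    refine hh.bdd_mul (c := 1) (Continuous.aestronglyMeasurable (by fun_prop)) (ae_of_all _ fun p => ?_)
    rw [Complex.norm_exp_ofReal_mul_I]
  have hGs : Integrable (fun q : ℝ × ℝ => G (c * q.1, d * q.2)) := by
    have : Integrable (fun q : ℝ × ℝ => Complex.exp (((-B q : ℝ) : ℂ) * Complex.I) *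
        (Complex.exp ((B q : ℂ) * Complex.I) * G (c * q.1, d * q.2))) := by
      refine hH.bdd_mul (c := 1) (Continuous.aestronglyMeasurable (by fun_prop)) (ae_of_all _ fun p => ?_)
      rw [Complex.norm_exp_ofReal_mul_I]
    refine this.congr (ae_of_all _ fun q => ?_)
    simp only
    rw [← mul_assoc, ← Complex.exp_add]
    simp
  have hpos : 0 < |c⁻¹ * d⁻¹| := by positivity
  have hG : Integrable G := by
    have := (scale_emb c d hc hd).integrable_map_iff (μ := volume) (g := G)
    rw [map_scale c d hc hd] at this
    have h2 := this.2 hGs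
    rwa [integrable_smul_measure (by simpa using hpos.ne') ENNReal.ofReal_ne_top] at h2
  filter_upwards [fourier_inv_ae_prod g hg hG] with p hp
  have cv := (scale_emb c d hc hd).integral_map (μ := volume) (fun q =>
     Complex.exp (((2 * π * (p.1 * q.1 + p.2 * q.2) : ℝ) : ℂ) * Complex.I) * G q)
  rw [map_scale c d hc hd, integral_smul_measure, ← hp, ENNReal.toReal_ofReal hpos.le] at cv
  have e : ∀ q : ℝ × ℝ, Complex.exp (((-(A p - 2 * π * (p.1 * (c * q.1) + p.2 * (d * q.2)) + B q) : ℝ) : ℂ)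
        * Complex.I) * (Complex.exp ((B q : ℂ) * Complex.I) * G (c * q.1, d * q.2)) =
      Complex.exp (((-A p : ℝ) : ℂ) * Complex.I) *
      (Complex.exp (((2 * π * (p.1 * (c * q.1) + p.2 * (d * q.2)) : ℝ) : ℂ) * Complex.I)
        * G (c * q.1, d * q.2)) := by
    intro q
    simp only [cexp_comb]
    congr 2
    push_cast; ring
  simp only [e]
  rw [integral_const_mul, ← cv, mul_smul_comm, smul_smul, ← abs_mul]
  have : c * d * (c⁻¹ * d⁻¹) = 1 := by field_simp
  rw [this, hgdef]
  simp only
  rw [← mul_assoc, ← Complex.exp_add]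
  simp

lemma qexp_qi_re (a : ℝ) : (qexp qi a).re = Real.cos a := by
  have h : (qi).re = 0 := rfl
  simp only [qexp, Quaternion.re_add, Quaternion.re_coe, Quaternion.re_smul, h]
  simp

lemma qexp_qi_imI (a : ℝ) : (qexp qi a).imI = Real.sin a := by
  have h : (qi).imI = 1 := rfl
  simp only [qexp, Quaternion.imI_add, Quaternion.imI_coe, Quaternion.imI_smul, h]
  simp

lemma qexp_qi_imJ (a : ℝ) : (qexp qi a).imJ = 0 := by
  have h : (qi).imJ = 0 := rfl
  simp only [qexp, Quaternion.imJ_add, Quaternion.imJ_coe, Quaternion.imJ_smul, h]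
  simp

lemma qexp_qi_imK (a : ℝ) : (qexp qi a).imK = 0 := by
  have h : (qi).imK = 0 := rfl
  simp only [qexp, Quaternion.imK_add, Quaternion.imK_coe, Quaternion.imK_smul, h]
  simp

lemma qexp_qj_re (a : ℝ) : (qexp qj a).re = Real.cos a := by
  have h : (qj).re = 0 := rfl
  simp only [qexp, Quaternion.re_add, Quaternion.re_coe, Quaternion.re_smul, h]
  simp

lemma qexp_qj_imI (a : ℝ) : (qexp qj a).imI = 0 := by
  have h : (qj).imI = 0 := rfl
  simp only [qexp, Quaternion.imI_add, Quaternion.imI_coe, Quaternion.imI_smul, h]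
  simp

lemma qexp_qj_imJ (a : ℝ) : (qexp qj a).imJ = Real.sin a := by
  have h : (qj).imJ = 1 := rfl
  simp only [qexp, Quaternion.imJ_add, Quaternion.imJ_coe, Quaternion.imJ_smul, h]
  simp

lemma qexp_qj_imK (a : ℝ) : (qexp qj a).imK = 0 := by
  have h : (qj).imK = 0 := rfl
  simp only [qexp, Quaternion.imK_add, Quaternion.imK_coe, Quaternion.imK_smul, h]
  simp

lemma qexp_qi_add (a b : ℝ) : qexp qi a * qexp qi b = qexp qi (a + b) := by
  ext <;> simp [qexp_qi_re, qexp_qi_imI, qexp_qi_imJ, qexp_qi_imK, Real.cos_add, Real.sin_add] <;> ring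

lemma qexp_qj_add (a b : ℝ) : qexp qj a * qexp qj b = qexp qj (a + b) := by
  ext <;> simp [qexp_qj_re, qexp_qj_imI, qexp_qj_imJ, qexp_qj_imK, Real.cos_add, Real.sin_add] <;> ring

lemma continuous_qexp (μ : ℍ[ℝ]) : Continuous (qexp μ) := by
  unfold qexp
  exact (Quaternion.continuous_coe.comp Real.continuous_cos).add
    (Real.continuous_sin.smul continuous_const)

lemma norm_qexp_qi (a : ℝ) : ‖qexp qi a‖ = 1 := by
  have h : ‖qexp qi a‖ * ‖qexp qi a‖ = 1 := by
    rw [← Quaternion.normSq_eq_norm_mul_self, Quaternion.normSq_def']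
    simp [qexp_qi_re, qexp_qi_imI, qexp_qi_imJ, qexp_qi_imK]
  nlinarith [norm_nonneg (qexp qi a)]

lemma norm_qexp_qj (a : ℝ) : ‖qexp qj a‖ = 1 := by
  have h : ‖qexp qj a‖ * ‖qexp qj a‖ = 1 := by
    rw [← Quaternion.normSq_eq_norm_mul_self, Quaternion.normSq_def']
    simp [qexp_qj_re, qexp_qj_imI, qexp_qj_imJ, qexp_qj_imK]
  nlinarith [norm_nonneg (qexp qj a)]

/-- The projections turning left multiplication by `i` and right multiplication by `j`
into complex scalar multiplication (`ε = ±1`). -/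
def projC (ε : ℝ) : ℍ[ℝ] →L[ℝ] ℂ :=
  LinearMap.toContinuousLinearMap
    { toFun := fun q => ⟨q.re - ε * q.imK, q.imI + ε * q.imJ⟩
      map_add' := fun x y => by apply Complex.ext <;> simp <;> ring
      map_smul' := fun r x => by apply Complex.ext <;> simp <;> ring }

lemma projC_apply (ε : ℝ) (q : ℍ[ℝ]) :
    projC ε q = ⟨q.re - ε * q.imK, q.imI + ε * q.imJ⟩ := rfl

lemma projC_mul (ε : ℝ) (hε : ε = 1 ∨ ε = -1) (α β : ℝ) (q : ℍ[ℝ]) :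
    projC ε (qexp qi α * q * qexp qj β) =
      Complex.exp (((α + ε * β : ℝ) : ℂ) * Complex.I) * projC ε q := by
  rw [Complex.exp_mul_I, ← Complex.ofReal_cos, ← Complex.ofReal_sin, projC_apply, projC_apply]
  rcases hε with rfl | rfl <;> apply Complex.ext <;>
    simp [qexp_qi_re, qexp_qi_imI, qexp_qi_imJ, qexp_qi_imK,
      qexp_qj_re, qexp_qj_imI, qexp_qj_imJ, qexp_qj_imK, Real.cos_add, Real.sin_add,
      -Complex.ofReal_cos, -Complex.ofReal_sin] <;> ring

lemma projC_inj (p q : ℍ[ℝ]) (h1 : projC 1 p = projC 1 q) (h2 : projC (-1) p = projC (-1) q) :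
    p = q := by
  simp only [projC_apply, Complex.mk.injEq] at h1 h2
  ext <;> linarith [h1.1, h1.2, h2.1, h2.2]

lemma integrable_two_sided (F : ℝ × ℝ → ℍ[ℝ]) (hF : Integrable F) (α β : ℝ × ℝ → ℝ)
    (hα : Continuous α) (hβ : Continuous β) :
    Integrable (fun p => qexp qi (α p) * F p * qexp qj (β p)) := by
  refine hF.mono ?_ (ae_of_all _ fun p => ?_)
  · exact ((((continuous_qexp qi).comp hα).aestronglyMeasurable).mul hF.1).mul
      (((continuous_qexp qj).comp hβ).aestronglyMeasurable)
  · simp [norm_qexp_qi, norm_qexp_qj]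

lemma projC_integral (ε : ℝ) (hε : ε = 1 ∨ ε = -1) (r : ℝ) (F : ℝ × ℝ → ℍ[ℝ]) (hF : Integrable F)
    (α β : ℝ × ℝ → ℝ) (hα : Continuous α) (hβ : Continuous β) :
    projC ε (∫ p, r • (qexp qi (α p) * F p * qexp qj (β p))) =
      r • ∫ p, Complex.exp (((α p + ε * β p : ℝ) : ℂ) * Complex.I) * projC ε (F p) := by
  rw [integral_smul, map_smul, ← ContinuousLinearMap.integral_comp_comm _
    (integrable_two_sided F hF α β hα hβ)]
  simp only [projC_mul ε hε]

lemma kernel_mul (r₁ r₂ x y z w : ℝ) (q : ℍ[ℝ]) :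
    (r₁ • (qexp qi x * qexp qi y)) * q * (r₂ • (qexp qj z * qexp qj w)) =
      (r₁ * r₂) • (qexp qi (x + y) * q * qexp qj (z + w)) := by
  rw [qexp_qi_add, qexp_qj_add, smul_mul_assoc, smul_mul_assoc, mul_smul_comm, smul_smul]

lemma main_proj (ε : ℝ) (hε : ε = 1 ∨ ε = -1) (a₁ b₁ d₁ a₂ b₂ d₂ : ℝ)
    (hb₁ : 0 < b₁) (hb₂ : 0 < b₂)
    (f : ℝ × ℝ → ℍ[ℝ]) (hf : Integrable f)
    (hL : Integrable (fun p : ℝ × ℝ => QLCT_T a₁ b₁ d₁ a₂ b₂ d₂ f p.1 p.2)) :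
    ∀ᵐ p : ℝ × ℝ, projC ε (f p) = projC ε (∫ q : ℝ × ℝ,
      KAiInv a₁ b₁ d₁ q.1 p.1 * QLCT_T a₁ b₁ d₁ a₂ b₂ d₂ f q.1 q.2 * KAjInv a₂ b₂ d₂ q.2 p.2) := by
  have hε2 : ε * ε = 1 := by rcases hε with rfl | rfl <;> norm_num
  have hεabs : |ε| = 1 := by rcases hε with rfl | rfl <;> norm_num
  have hε0 : ε ≠ 0 := by rcases hε with rfl | rfl <;> norm_num
  set r : ℝ := (Real.sqrt (2 * π * b₁))⁻¹ * (Real.sqrt (2 * π * b₂))⁻¹ with hr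
  have hrpos : 0 < r := by positivity
  set c : ℝ := 1 / (2 * π * b₁) with hc
  set d : ℝ := ε / (2 * π * b₂) with hd
  have hc0 : c ≠ 0 := by positivity
  have hd0 : d ≠ 0 := by rw [hd]; positivity
  have hrr : r * r = |c * d| := by
    rw [hr, hc, hd, abs_mul, abs_div, abs_div, hεabs, abs_one, abs_of_pos (by positivity : 0 < 2 * π * b₁),
      abs_of_pos (by positivity : 0 < 2 * π * b₂), mul_mul_mul_comm, ← mul_inv, ← mul_inv,
      Real.mul_self_sqrt (by positivity), Real.mul_self_sqrt (by positivity), one_div, one_div]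
  set A : ℝ × ℝ → ℝ := fun p => -(π / 4) + a₁ * p.1 ^ 2 / (2 * b₁) +
    ε * (-(π / 4) + a₂ * p.2 ^ 2 / (2 * b₂)) with hA
  set B : ℝ × ℝ → ℝ := fun q => d₁ * q.1 ^ 2 / (2 * b₁) + ε * (d₂ * q.2 ^ 2 / (2 * b₂)) with hB
  have hAc : Continuous A := by fun_prop
  have hBc : Continuous B := by fun_prop
  set H : ℝ × ℝ → ℂ := fun q => ∫ p : ℝ × ℝ,
      Complex.exp (((A p - 2 * π * (p.1 * (c * q.1) + p.2 * (d * q.2)) + B q : ℝ) : ℂ) * Complex.I)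
        * projC ε (f p) with hH
  have key : ∀ q : ℝ × ℝ, projC ε (QLCT_T a₁ b₁ d₁ a₂ b₂ d₂ f q.1 q.2) = r • H q := by
    intro q
    simp only [QLCT_T, KAi, KAj, kernel_mul]
    rw [projC_integral ε hε _ f hf _ _ (by fun_prop) (by fun_prop)]
    simp only [hH]
    congr 2
    ext p
    congr 4
    simp only [hA, hB, hc, hd]
    field_simp
    ring
  have hHint : Integrable H := by
    have h1 : Integrable (fun q : ℝ × ℝ => r⁻¹ • projC ε (QLCT_T a₁ b₁ d₁ a₂ b₂ d₂ f q.1 q.2)) :=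
      ((projC ε).integrable_comp hL).smul r⁻¹
    refine h1.congr (ae_of_all _ fun q => ?_)
    simp only [key]
    rw [smul_smul, inv_mul_cancel₀ hrpos.ne', one_smul]
  have hs := scalar_inv A B hAc hBc c d hc0 hd0 (fun p => projC ε (f p))
    ((projC ε).integrable_comp hf) hHint
  filter_upwards [hs] with p hp
  rw [hp]
  simp only [KAiInv, KAjInv, kernel_mul]
  rw [projC_integral ε hε _ (fun q => QLCT_T a₁ b₁ d₁ a₂ b₂ d₂ f q.1 q.2) hL _ _
    (by fun_prop) (by fun_prop)]
  simp only [key, mul_smul_comm]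
  rw [integral_smul, smul_smul, ← hr, hrr]
  congr 2
  ext q
  congr 4
  simp only [hA, hB, hc, hd]
  field_simp
  ring

/-- Inversion theorem for the two-sided QLCT of an integrable function with integrable QLCT. -/
theorem qlct_two_sided_inversion_L1
    (a₁ b₁ c₁ d₁ a₂ b₂ c₂ d₂ : ℝ)
    (hA₁ : a₁ * d₁ - b₁ * c₁ = 1) (hA₂ : a₂ * d₂ - b₂ * c₂ = 1)
    (hb₁ : 0 < b₁) (hb₂ : 0 < b₂)
    (f : ℝ × ℝ → ℍ[ℝ]) (hf : Integrable f)
    (hL : Integrable (fun p : ℝ × ℝ => QLCT_T a₁ b₁ d₁ a₂ b₂ d₂ f p.1 p.2)) :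
    ∀ᵐ p : ℝ × ℝ, f p = ∫ q : ℝ × ℝ,
      KAiInv a₁ b₁ d₁ q.1 p.1 * QLCT_T a₁ b₁ d₁ a₂ b₂ d₂ f q.1 q.2 * KAjInv a₂ b₂ d₂ q.2 p.2 := by
  filter_upwards [main_proj 1 (Or.inl rfl) a₁ b₁ d₁ a₂ b₂ d₂ hb₁ hb₂ f hf hL,
    main_proj (-1) (Or.inr rfl) a₁ b₁ d₁ a₂ b₂ d₂ hb₁ hb₂ f hf hL] with p h1 h2
  exact projC_inj _ _ h1 h2
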